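/- Let a_1, a_2 be coprime integers with a_1·a_2 ≠ 0, and let (u_n) be the nondegenerate Lucas sequence defined by u_0 = 0, u_1 = 1, u_n = a_1·u_{n−1} + a_2·u_{n−2} for n ≥ 2. Let k be a positive integer with gcd(k, a_2) = 1 and k = gcd(ℓ_u(k), |u_{ℓ_u(k)}|) (equivalently, A_{u,k} ≠ ∅). Then A_{u,k} = {n ≥ 1 : gcd(n, u_n) = k} has an asymptotic density, given by d(A_{u,k}) = ∑_{d ≥ 1, gcd(d, a_2) = 1} μ(d) / ℓ_u(dk), and this series is absolutely convergent. -/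

import Mathlib

open scoped BigOperators

/-- The Lucas sequence with parameters `a1`, `a2`:
`u 0 = 0`, `u 1 = 1`, `u (n+2) = a1 * u (n+1) + a2 * u n`. -/
def lucasU (a1 a2 : ℤ) : ℕ → ℤ
  | 0 => 0
  | 1 => 1
  | n + 2 => a1 * lucasU a1 a2 (n + 1) + a2 * lucasU a1 a2 n

/-- Rank of appearance of `m` in the Lucas sequence. -/
noncomputable def lucasZ (a1 a2 : ℤ) (m : ℕ) : ℕ :=
  sInf {n : ℕ | 0 < n ∧ (m : ℤ) ∣ lucasU a1 a2 n}

/-- `lucasL a1 a2 m = lcm(m, z_u(m))`. -/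
noncomputable def lucasL (a1 a2 : ℤ) (m : ℕ) : ℕ := Nat.lcm m (lucasZ a1 a2 m)

/-- The set of positive integers `n` with `gcd(n, u_n) = k`. -/
def lucasA (a1 a2 : ℤ) (k : ℕ) : Set ℕ :=
  {n : ℕ | 0 < n ∧ Int.gcd (n : ℤ) (lucasU a1 a2 n) = k}

/-- Nondegeneracy: the ratio of the roots of `X^2 - a1*X - a2` is not a root of unity. -/
def LucasNondegenerate (a1 a2 : ℤ) : Prop :=
  ∀ α β : ℂ, α + β = (a1 : ℂ) → α * β = -(a2 : ℂ) →
    ∀ n : ℕ, 0 < n → (α / β) ^ n ≠ 1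

/-- `countIn S x` is the number of elements of `S` in `[1, x]`. -/
noncomputable def countIn (S : Set ℕ) (x : ℝ) : ℕ :=
  (S ∩ {n : ℕ | 1 ≤ n ∧ (n : ℝ) ≤ x}).ncard

/-- `S` has asymptotic density `a`. -/
def HasDensity (S : Set ℕ) (a : ℝ) : Prop :=
  Filter.Tendsto (fun x : ℝ => (countIn S x : ℝ) / x) Filter.atTop (nhds a)

section Lucas

variable {a1 a2 : ℤ}

lemma natCast_mul_gcd_eq_one {c d : ℕ} {a : ℤ} (hc : Int.gcd c a = 1) (hd : Int.gcd d a = 1) :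
    Int.gcd (c * d : ℕ) a = 1 :=
  Nat.Coprime.mul_left hc hd

lemma lucasU_add_two (n : ℕ) :
    lucasU a1 a2 (n + 2) = a1 * lucasU a1 a2 (n + 1) + a2 * lucasU a1 a2 n := rfl

lemma lucasU_add (m n : ℕ) : lucasU a1 a2 (m + n + 1) =
    lucasU a1 a2 (m + 1) * lucasU a1 a2 (n + 1) + a2 * lucasU a1 a2 m * lucasU a1 a2 n := by
  induction n using Nat.twoStepInduction with
  | zero => simp [lucasU]
  | one => simp [lucasU, mul_comm]
  | more n h0 h1 =>
    have e1 : lucasU a1 a2 (m + (n + 2) + 1) =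
        a1 * lucasU a1 a2 (m + (n + 1) + 1) + a2 * lucasU a1 a2 (m + n + 1) := rfl
    rw [e1, h0, h1, lucasU_add_two (n + 1), lucasU_add_two n]
    ring

lemma isCoprime_lucasU_succ_right (hco : IsCoprime a1 a2) (n : ℕ) :
    IsCoprime (lucasU a1 a2 (n + 1)) a2 := by
  induction n with
  | zero => exact isCoprime_one_left
  | succ n ih => exact (hco.mul_left ih).add_mul_left_left _

lemma isCoprime_lucasU_succ (hco : IsCoprime a1 a2) (n : ℕ) :
    IsCoprime (lucasU a1 a2 n) (lucasU a1 a2 (n + 1)) := by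
  induction n with
  | zero => exact isCoprime_one_right
  | succ n ih =>
    have h : IsCoprime (lucasU a1 a2 (n + 1)) (a2 * lucasU a1 a2 n) :=
      (isCoprime_lucasU_succ_right hco n).mul_right ih.symm
    rw [lucasU_add_two n, add_comm (a1 * _)]
    exact h.add_mul_right_right _

/-- The Binet formula, cleared of denominators. -/
lemma sub_mul_lucasU {R : Type*} [CommRing R] {α β : R} (hs : α + β = a1) (hp : α * β = -a2)
    (n : ℕ) : (α - β) * (lucasU a1 a2 n : R) = α ^ n - β ^ n := by
  induction n using Nat.twoStepInduction with
  | zero => simp [lucasU]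
  | one => simp [lucasU]
  | more n h0 h1 =>
    have h2 : (a2 : R) = -(α * β) := by rw [hp, neg_neg]
    rw [lucasU_add_two]
    push_cast
    rw [← hs, h2]
    linear_combination (α + β) * h1 - α * β * h0

lemma exists_roots {K : Type*} [Field K] [IsAlgClosed K] (a b : K) :
    ∃ α β : K, α + β = a ∧ α * β = -b := by
  have hd : (Polynomial.X ^ 2 - Polynomial.C a * Polynomial.X - Polynomial.C b).degree ≠ 0 := by
    have : (Polynomial.X ^ 2 - Polynomial.C a * Polynomial.X - Polynomial.C b).degree = 2 := by
      compute_degree!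
    rw [this]; decide
  obtain ⟨x, hx⟩ := IsAlgClosed.exists_root _ hd
  refine ⟨x, a - x, by ring, ?_⟩
  simp only [Polynomial.IsRoot.def, Polynomial.eval_sub, Polynomial.eval_pow, Polynomial.eval_X,
    Polynomial.eval_mul, Polynomial.eval_C] at hx
  linear_combination -hx

lemma LucasNondegenerate.disc_ne_zero (hnd : LucasNondegenerate a1 a2) (h1 : a1 ≠ 0) :
    a1 ^ 2 + 4 * a2 ≠ 0 := by
  intro h
  have h' : (a1 : ℂ) ^ 2 + 4 * a2 = 0 := by exact_mod_cast h
  have h1' : (a1 : ℂ) ≠ 0 := by exact_mod_cast h1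
  refine hnd (a1 / 2) (a1 / 2) (by ring) (by linear_combination h' / 4) 1 one_pos ?_
  rw [pow_one, div_self (div_ne_zero h1' two_ne_zero)]

lemma LucasNondegenerate.lucasU_ne_zero (hnd : LucasNondegenerate a1 a2) (h2 : a2 ≠ 0) {n : ℕ}
    (hn : 0 < n) : lucasU a1 a2 n ≠ 0 := by
  intro h
  obtain ⟨α, β, hs, hp⟩ := exists_roots (a1 : ℂ) (a2 : ℂ)
  have hβ : β ≠ 0 := by
    rintro rfl
    have h2' : (a2 : ℂ) ≠ 0 := by exact_mod_cast h2
    exact h2' (by linear_combination hp)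
  have hb := sub_mul_lucasU hs hp n
  rw [h, Int.cast_zero, mul_zero] at hb
  refine hnd α β hs hp n hn ?_
  rw [div_pow, div_eq_one_iff_eq (pow_ne_zero _ hβ)]
  exact (sub_eq_zero.mp hb.symm)

lemma abs_lucasU_le (n : ℕ) : |lucasU a1 a2 n| ≤ (1 + |a1| + |a2|) ^ n := by
  have hA : 1 ≤ 1 + |a1| + |a2| := by have := abs_nonneg a1; have := abs_nonneg a2; linarith
  induction n using Nat.twoStepInduction with
  | zero => simp [lucasU]
  | one => simpa [lucasU] using hA
  | more n h0 h1 =>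
    have hm : (1 + |a1| + |a2|) ^ n ≤ (1 + |a1| + |a2|) ^ (n + 1) :=
      pow_le_pow_right₀ hA (Nat.le_succ n)
    have hpos : 0 ≤ (1 + |a1| + |a2|) ^ (n + 1) := by positivity
    calc |lucasU a1 a2 (n + 2)|
        ≤ |a1| * |lucasU a1 a2 (n + 1)| + |a2| * |lucasU a1 a2 n| := by
          rw [lucasU_add_two, ← abs_mul, ← abs_mul]; exact abs_add_le _ _
      _ ≤ |a1| * (1 + |a1| + |a2|) ^ (n + 1) + |a2| * (1 + |a1| + |a2|) ^ (n + 1) := by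
          gcongr; exact h0.trans hm
      _ ≤ (1 + |a1| + |a2|) ^ (n + 2) := by
          rw [pow_succ _ (n + 1)]; nlinarith

/-- Modulo a prime not dividing the discriminant, the Lucas sequence has no zero whose index is
a proper multiple by `p` of a nonzero index. -/
lemma dvd_lucasU_of_dvd_lucasU_mul {p : ℕ} [Fact p.Prime] (hp : ¬ (p : ℤ) ∣ a1 ^ 2 + 4 * a2)
    {m : ℕ} (h : (p : ℤ) ∣ lucasU a1 a2 (m * p)) : (p : ℤ) ∣ lucasU a1 a2 m := by
  let K := AlgebraicClosure (ZMod p)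
  have : CharP K p := charP_of_injective_algebraMap (algebraMap (ZMod p) K).injective p
  obtain ⟨α, β, hs, hq⟩ := exists_roots (a1 : K) (a2 : K)
  have hαβ : α - β ≠ 0 := by
    intro h0
    apply hp
    rw [← CharP.intCast_eq_zero_iff K p]
    have h1 : ((a1 ^ 2 + 4 * a2 : ℤ) : K) = (a1 : K) ^ 2 + 4 * (a2 : K) := by
      rw [Int.cast_add, Int.cast_mul, Int.cast_pow, Int.cast_ofNat]
    rw [h1, ← hs, show (a2 : K) = -(α * β) by rw [hq, neg_neg]]
    linear_combination (α - β) * h0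
  rw [← CharP.intCast_eq_zero_iff K p] at h ⊢
  have h1 := sub_mul_lucasU hs hq (m * p)
  rw [h, mul_zero, pow_mul, pow_mul, ← sub_pow_char] at h1
  have h2 : α ^ m - β ^ m = 0 := eq_zero_of_pow_eq_zero h1.symm
  rw [← sub_mul_lucasU hs hq m] at h2
  exact (mul_eq_zero.mp h2).resolve_left hαβ

lemma exists_dvd_lucasU {d : ℕ} (hd : 0 < d) (h : Int.gcd d a2 = 1) :
    ∃ n, 0 < n ∧ (d : ℤ) ∣ lucasU a1 a2 n := by
  have : NeZero d := ⟨hd.ne'⟩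
  have hu : IsUnit (a2 : ZMod d) := by
    rw [ZMod.coe_int_isUnit_iff_isCoprime, Int.isCoprime_iff_gcd_eq_one]
    exact h
  let M : Matrix (Fin 2) (Fin 2) (ZMod d) := !![(a1 : ZMod d), a2; 1, 0]
  have hM : IsUnit M := by
    rw [Matrix.isUnit_iff_isUnit_det, Matrix.det_fin_two_of]
    simpa using hu
  have hpow : ∀ n : ℕ, (M ^ (n + 1)) 1 0 = (lucasU a1 a2 (n + 1) : ZMod d) ∧
      (M ^ (n + 1)) 1 1 = a2 * (lucasU a1 a2 n : ZMod d) := by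
    intro n
    induction n with
    | zero => simp [M, lucasU]
    | succ n ih =>
      rw [pow_succ, Matrix.mul_apply, Matrix.mul_apply]
      simp only [Fin.sum_univ_two, ih.1, ih.2]
      refine ⟨?_, ?_⟩
      · rw [lucasU_add_two]; simp [M]; ring
      · simp [M]; ring
  obtain ⟨n, hn, h1⟩ := isOfFinOrder_iff_pow_eq_one.mp (isOfFinOrder_of_finite hM.unit)
  refine ⟨n, hn, ?_⟩
  obtain ⟨k, rfl⟩ := Nat.exists_eq_succ_of_ne_zero hn.ne'
  rw [← ZMod.intCast_zmod_eq_zero_iff_dvd, ← (hpow k).1]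
  have h2 : M ^ (k + 1) = 1 := by
    have := congrArg Units.val h1
    simpa using this
  rw [h2]; rfl

lemma lucasZ_spec {d : ℕ} (hd : 0 < d) (h : Int.gcd d a2 = 1) :
    0 < lucasZ a1 a2 d ∧ (d : ℤ) ∣ lucasU a1 a2 (lucasZ a1 a2 d) :=
  Nat.sInf_mem (s := {n : ℕ | 0 < n ∧ (d : ℤ) ∣ lucasU a1 a2 n}) (exists_dvd_lucasU hd h)

lemma dvd_lucasU_add_iff (hco : IsCoprime a1 a2) {d : ℤ} {m : ℕ} (hm : d ∣ lucasU a1 a2 m)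
    (n : ℕ) : d ∣ lucasU a1 a2 (m + n) ↔ d ∣ lucasU a1 a2 n := by
  cases n with
  | zero => simpa [lucasU] using hm
  | succ n =>
    have hc : IsCoprime d (lucasU a1 a2 (m + 1)) :=
      (isCoprime_lucasU_succ hco m).of_isCoprime_of_dvd_left hm
    rw [← add_assoc, lucasU_add, dvd_add_left ((hm.mul_left _).mul_right _)]
    exact ⟨fun h => hc.dvd_of_dvd_mul_left h, fun h => h.mul_left _⟩

lemma dvd_lucasU_iff (hco : IsCoprime a1 a2) {d : ℕ} (hd : 0 < d) (h : Int.gcd d a2 = 1)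
    (n : ℕ) : (d : ℤ) ∣ lucasU a1 a2 n ↔ lucasZ a1 a2 d ∣ n := by
  obtain ⟨hz, hdz⟩ := lucasZ_spec (a1 := a1) hd h
  induction n using Nat.strong_induction_on with
  | _ n ih =>
    rcases lt_or_ge n (lucasZ a1 a2 d) with hlt | hge
    · rcases Nat.eq_zero_or_pos n with rfl | hn
      · simp [lucasU]
      · refine ⟨fun hdvd => ?_, fun hdvd => absurd (Nat.le_of_dvd hn hdvd) hlt.not_ge⟩
        exact absurd (Nat.sInf_le (s := {n : ℕ | 0 < n ∧ (d : ℤ) ∣ lucasU a1 a2 n}) ⟨hn, hdvd⟩)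
          hlt.not_ge
    · obtain ⟨k, rfl⟩ := Nat.exists_eq_add_of_le hge
      rw [dvd_lucasU_add_iff hco hdz, ih k (by omega), Nat.dvd_add_right (dvd_refl _)]

lemma lucasZ_dvd_lucasZ (hco : IsCoprime a1 a2) {c d : ℕ} (hd : 0 < d) (h : Int.gcd d a2 = 1)
    (hcd : c ∣ d) : lucasZ a1 a2 c ∣ lucasZ a1 a2 d := by
  have hc : Int.gcd c a2 = 1 := Nat.Coprime.coprime_dvd_left (by simpa using hcd) h
  rw [← dvd_lucasU_iff hco (Nat.pos_of_dvd_of_pos hcd hd) hc]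
  exact (Int.natCast_dvd_natCast.mpr hcd).trans (lucasZ_spec hd h).2

lemma lucasL_pos {d : ℕ} (hd : 0 < d) (h : Int.gcd d a2 = 1) : 0 < lucasL a1 a2 d :=
  Nat.lcm_pos hd (lucasZ_spec hd h).1

/-- `d` divides `gcd(n, u_n)` exactly when `d` is coprime to `a2` and `ℓ_u(d)` divides `n`. -/
lemma dvd_gcd_lucasU_iff (hco : IsCoprime a1 a2) {d n : ℕ} (hd : 0 < d) (hn : 0 < n) :
    d ∣ Int.gcd n (lucasU a1 a2 n) ↔ Int.gcd d a2 = 1 ∧ lucasL a1 a2 d ∣ n := by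
  have key : d ∣ Int.gcd n (lucasU a1 a2 n) ↔ d ∣ n ∧ (d : ℤ) ∣ lucasU a1 a2 n := by
    rw [← Int.natCast_dvd_natCast, Int.dvd_coe_gcd_iff, Int.natCast_dvd_natCast]
  rw [key]
  constructor
  · rintro ⟨h1, h2⟩
    have hg : Int.gcd d a2 = 1 := by
      obtain ⟨k, rfl⟩ := Nat.exists_eq_succ_of_ne_zero hn.ne'
      exact Int.isCoprime_iff_gcd_eq_one.mp
        ((isCoprime_lucasU_succ_right hco k).of_isCoprime_of_dvd_left h2)
    exact ⟨hg, Nat.lcm_dvd h1 ((dvd_lucasU_iff hco hd hg n).mp h2)⟩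
  · rintro ⟨hg, h⟩
    exact ⟨(Nat.dvd_lcm_left _ _).trans h,
      (dvd_lucasU_iff hco hd hg n).mpr ((Nat.dvd_lcm_right _ _).trans h)⟩

lemma not_dvd_lucasZ_self (hco : IsCoprime a1 a2) {p : ℕ} (hp : p.Prime)
    (hpa : Int.gcd p a2 = 1) (hpd : ¬ (p : ℤ) ∣ a1 ^ 2 + 4 * a2) : ¬ p ∣ lucasZ a1 a2 p := by
  have := Fact.mk hp
  rintro ⟨m, hm⟩
  obtain ⟨hz, hdz⟩ := lucasZ_spec (a1 := a1) hp.pos hpa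
  rw [hm, mul_comm] at hdz
  have h1 := (dvd_lucasU_iff hco hp.pos hpa m).mp (dvd_lucasU_of_dvd_lucasU_mul hpd hdz)
  have hm0 : 0 < m := by
    rcases Nat.eq_zero_or_pos m with rfl | h
    · simp at hm; omega
    · exact h
  have h2 := Nat.le_of_dvd hm0 h1
  have := hp.two_le
  nlinarith

end Lucas

section PrimeSums

open Nat in
lemma sum_log_div_primesLE_le {N : ℕ} (hN : 0 < N) :
    ∑ q ∈ primesLE N, Real.log q / q ≤ Real.log N + Real.log 4 := by
  have hN' : (0 : ℝ) < N := by exact_mod_cast hN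
  have hprime : ∀ q ∈ primesLE N, q.Prime := fun q hq => (mem_primesLE.mp hq).2
  have hdvd : ∏ q ∈ primesLE N, q ^ (N / q) ∣ N ! := by
    refine Finset.prod_dvd_of_isRelPrime ?_ ?_
    · intro p hp q hq hpq
      exact Nat.coprime_iff_isRelPrime.mp
        (((Nat.coprime_primes (hprime p hp) (hprime q hq)).mpr hpq).pow _ _)
    · intro q hq
      rw [(hprime q hq).pow_dvd_factorial_iff (Nat.lt_succ_self _)]
      have hmem : 1 ∈ Finset.Ico 1 (Nat.log q N).succ := by
        have h2 : 0 < Nat.log q N := Nat.log_pos (hprime q hq).one_lt (mem_primesLE.mp hq).1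
        simp only [Finset.mem_Ico]; omega
      simpa using Finset.single_le_sum (f := fun i => N / q ^ i) (fun _ _ => Nat.zero_le _) hmem
  have hle : ∏ q ∈ primesLE N, q ^ (N / q) ≤ N ^ N :=
    (Nat.le_of_dvd (Nat.factorial_pos N) hdvd).trans (Nat.factorial_le_pow N)
  have hlog : ∑ q ∈ primesLE N, (N / q : ℕ) * Real.log q ≤ N * Real.log N := by
    have h1 : ((∏ q ∈ primesLE N, q ^ (N / q) : ℕ) : ℝ) ≤ (N : ℝ) ^ N := by exact_mod_cast hle
    have h2 : (0 : ℝ) < ((∏ q ∈ primesLE N, q ^ (N / q) : ℕ) : ℝ) := by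
      exact_mod_cast Finset.prod_pos fun q hq => pow_pos (hprime q hq).pos _
    have h3 := Real.log_le_log h2 h1
    rw [Real.log_pow] at h3
    refine le_trans (le_of_eq ?_) h3
    push_cast
    rw [Real.log_prod fun q hq => pow_ne_zero _ (by exact_mod_cast (hprime q hq).ne_zero)]
    exact Finset.sum_congr rfl fun q _ => (Real.log_pow _ _).symm
  have htheta : ∑ q ∈ primesLE N, Real.log q ≤ Real.log 4 * N := by
    rw [← Chebyshev.theta_eq_sum_primesLE_log]
    exact Chebyshev.theta_le_log4_mul_x hN'.le
  have hmul : N * ∑ q ∈ primesLE N, Real.log q / q ≤ N * (Real.log N + Real.log 4) := by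
    calc N * ∑ q ∈ primesLE N, Real.log q / q
        ≤ ∑ q ∈ primesLE N, ((N / q : ℕ) * Real.log q + Real.log q) := by
          rw [Finset.mul_sum]
          refine Finset.sum_le_sum fun q hq => ?_
          have h0 : (0 : ℝ) ≤ Real.log q := Real.log_natCast_nonneg q
          have h1 : (N : ℝ) / q ≤ (N / q : ℕ) + 1 := by
            rw [← Nat.floor_div_eq_div (K := ℝ)]; exact (Nat.lt_floor_add_one _).le
          calc (N : ℝ) * (Real.log q / q) = (N : ℝ) / q * Real.log q := by ring
            _ ≤ ((N / q : ℕ) + 1) * Real.log q := by gcongr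
            _ = _ := by ring
      _ ≤ N * (Real.log N + Real.log 4) := by
          rw [Finset.sum_add_distrib]; linarith
  exact le_of_mul_le_mul_left hmul (Nat.cast_pos.mpr hN)

/-- The sum of reciprocals of the divisors of a primorial grows slower than any positive power. -/
lemma exists_sum_inv_divisors_primorial_le {δ : ℝ} (hδ : 0 < δ) :
    ∃ C : ℝ, 0 < C ∧ ∀ N : ℕ, 0 < N →
      ∑ m ∈ (primorial N).divisors, (m : ℝ)⁻¹ ≤ C * (N : ℝ) ^ δ := by
  let T : ℕ := ⌊Real.exp δ⁻¹⌋₊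
  refine ⟨Real.exp (T + 1 + δ * Real.log 4), Real.exp_pos _, fun N hN => ?_⟩
  have hN' : (0 : ℝ) < N := by exact_mod_cast hN
  have hprod : ∑ m ∈ (primorial N).divisors, (m : ℝ)⁻¹ =
      ∏ q ∈ Nat.primesLE N, (1 + (q : ℝ)⁻¹) := by
    let f : ArithmeticFunction ℝ := ⟨fun n => (n : ℝ)⁻¹, by simp⟩
    have hf : f.IsMultiplicative := ⟨by simp [f], fun {m n} _ => by simp [f, mul_comm]⟩
    have := hf.prodPrimeFactors_one_add_of_squarefree (squarefree_primorial N)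
    rw [primeFactors_primorial] at this
    exact this.symm
  have hbound : ∑ q ∈ Nat.primesLE N, (q : ℝ)⁻¹ ≤
      T + 1 + δ * (Real.log N + Real.log 4) := by
    calc ∑ q ∈ Nat.primesLE N, (q : ℝ)⁻¹
        ≤ ∑ q ∈ Nat.primesLE N, ((if q ∈ Finset.range (T + 1) then 1 else 0) +
            δ * (Real.log q / q)) := by
          refine Finset.sum_le_sum fun q hq => ?_
          have hq1 : (1 : ℝ) ≤ q := by exact_mod_cast (Nat.mem_primesLE.mp hq).2.one_le
          have hl : 0 ≤ Real.log q := Real.log_nonneg hq1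
          split_ifs with h
          · have : (q : ℝ)⁻¹ ≤ 1 := inv_le_one_of_one_le₀ hq1
            have : 0 ≤ δ * (Real.log q / q) := by positivity
            linarith
          · rw [Finset.mem_range, not_lt] at h
            have h1 : Real.exp δ⁻¹ < q := Nat.lt_of_floor_lt h
            have h2 : δ⁻¹ ≤ Real.log q := (Real.le_log_iff_exp_le (by linarith)).mpr h1.le
            have h3 : 1 ≤ δ * Real.log q := by
              rw [inv_le_iff_one_le_mul₀' hδ] at h2; exact h2
            rw [zero_add, inv_eq_one_div, ← mul_div_assoc]
            gcongr
      _ ≤ (T + 1) + δ * (Real.log N + Real.log 4) := by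
          rw [Finset.sum_add_distrib, ← Finset.mul_sum]
          gcongr
          · rw [← Finset.sum_filter, Finset.sum_const, nsmul_eq_mul, mul_one]
            have : ((Nat.primesLE N).filter (· ∈ Finset.range (T + 1))).card ≤ T + 1 := by
              refine (Finset.card_le_card (t := Finset.range (T + 1)) ?_).trans_eq
                (Finset.card_range _)
              intro q hq; exact (Finset.mem_filter.mp hq).2
            exact_mod_cast this
          · exact sum_log_div_primesLE_le hN
  calc ∑ m ∈ (primorial N).divisors, (m : ℝ)⁻¹
      = ∏ q ∈ Nat.primesLE N, (1 + (q : ℝ)⁻¹) := hprod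
    _ ≤ ∏ q ∈ Nat.primesLE N, Real.exp ((q : ℝ)⁻¹) := by
        refine Finset.prod_le_prod (fun q _ => by positivity) fun q _ => ?_
        rw [add_comm]; exact Real.add_one_le_exp _
    _ = Real.exp (∑ q ∈ Nat.primesLE N, (q : ℝ)⁻¹) := (Real.exp_sum _ _).symm
    _ ≤ Real.exp (T + 1 + δ * (Real.log N + Real.log 4)) := Real.exp_le_exp.mpr hbound
    _ = Real.exp (T + 1 + δ * Real.log 4) * (N : ℝ) ^ δ := by
        rw [Real.rpow_def_of_pos hN', ← Real.exp_add]; congr 1; ring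

lemma card_divisors_le_two_mul_sqrt (n : ℕ) : (n.divisors.card : ℝ) ≤ 2 * √n := by
  have h : n.divisors ⊆ Finset.Icc 1 n.sqrt ∪ (Finset.Icc 1 n.sqrt).image (n / ·) := by
    intro d hd
    obtain ⟨hdn, hn⟩ := Nat.mem_divisors.mp hd
    have hd0 : 0 < d := Nat.pos_of_dvd_of_pos hdn (Nat.pos_of_ne_zero hn)
    rw [Finset.mem_union, Finset.mem_Icc, Finset.mem_image]
    rcases le_or_gt d n.sqrt with hle | hgt
    · exact Or.inl ⟨hd0, hle⟩
    · refine Or.inr ⟨n / d, Finset.mem_Icc.mpr ⟨?_, ?_⟩, Nat.div_div_self hdn hn⟩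
      · exact Nat.div_pos (Nat.le_of_dvd (Nat.pos_of_ne_zero hn) hdn) hd0
      · rw [← Nat.lt_succ_iff, Nat.div_lt_iff_lt_mul hd0]
        calc n < (n.sqrt + 1) * (n.sqrt + 1) := Nat.lt_succ_sqrt n
          _ ≤ (n.sqrt + 1) * d := Nat.mul_le_mul_left _ hgt
  have h1 : n.divisors.card ≤ 2 * n.sqrt := by
    refine (Finset.card_le_card h).trans ((Finset.card_union_le _ _).trans ?_)
    have := Finset.card_image_le (s := Finset.Icc 1 n.sqrt) (f := (n / ·))
    simp only [Nat.card_Icc, Nat.add_sub_cancel] at *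
    omega
  calc (n.divisors.card : ℝ) ≤ 2 * (n.sqrt : ℝ) := by exact_mod_cast h1
    _ ≤ 2 * √n := by gcongr; exact Real.nat_sqrt_le_real_sqrt

/-- Sums of `1 / lcm(m, e)` over the divisors `m` of `Q`. -/
lemma sum_gcd_div_le {Q e : ℕ} (he : 0 < e) :
    ∑ m ∈ Q.divisors, (Nat.gcd m e : ℝ) / m ≤
      e.divisors.card * ∑ m ∈ Q.divisors, (m : ℝ)⁻¹ := by
  calc ∑ m ∈ Q.divisors, (Nat.gcd m e : ℝ) / m
      ≤ ∑ m ∈ Q.divisors, ∑ g ∈ e.divisors, if g ∣ m then (g : ℝ) / m else 0 := by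
        refine Finset.sum_le_sum fun m hm => ?_
        have hg : Nat.gcd m e ∈ e.divisors :=
          Nat.mem_divisors.mpr ⟨Nat.gcd_dvd_right _ _, he.ne'⟩
        refine le_trans ?_ (Finset.single_le_sum
          (f := fun g : ℕ => if g ∣ m then (g : ℝ) / m else 0) (fun g _ => ?_) hg)
        · simp only [Nat.gcd_dvd_left, if_true, le_refl]
        · split_ifs <;> positivity
    _ = ∑ g ∈ e.divisors, ∑ m ∈ Q.divisors with g ∣ m, (g : ℝ) / m := by
        rw [Finset.sum_comm]; simp_rw [Finset.sum_filter]
    _ ≤ ∑ g ∈ e.divisors, ∑ m ∈ Q.divisors, (m : ℝ)⁻¹ := by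
        refine Finset.sum_le_sum fun g hg => ?_
        have hg0 : 0 < g := Nat.pos_of_mem_divisors hg
        have hg0' : (g : ℝ) ≠ 0 := by exact_mod_cast hg0.ne'
        have hinj : Set.InjOn (· / g) (Q.divisors.filter (g ∣ ·) : Set ℕ) := by
          intro a ha b hb hab
          simp only [Finset.coe_filter, Set.mem_ofPred_eq] at ha hb
          rw [← Nat.div_mul_cancel ha.2, ← Nat.div_mul_cancel hb.2]
          exact congrArg (· * g) hab
        calc ∑ m ∈ Q.divisors with g ∣ m, (g : ℝ) / m
            = ∑ m ∈ Q.divisors with g ∣ m, ((m / g : ℕ) : ℝ)⁻¹ := by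
              refine Finset.sum_congr rfl fun m hm => ?_
              rw [Nat.cast_div (Finset.mem_filter.mp hm).2 hg0', inv_div]
          _ = ∑ m ∈ (Q.divisors.filter (g ∣ ·)).image (· / g), (m : ℝ)⁻¹ :=
              (Finset.sum_image (f := fun m : ℕ => (m : ℝ)⁻¹) hinj).symm
          _ ≤ ∑ m ∈ Q.divisors, (m : ℝ)⁻¹ := by
              refine Finset.sum_le_sum_of_subset_of_nonneg ?_ fun _ _ _ => by positivity
              intro m hm
              obtain ⟨c, hc, rfl⟩ := Finset.mem_image.mp hm
              obtain ⟨hc, hgc⟩ := Finset.mem_filter.mp hc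
              exact Nat.mem_divisors.mpr ⟨(Nat.div_dvd_of_dvd hgc).trans
                (Nat.dvd_of_mem_divisors hc), (Nat.mem_divisors.mp hc).2⟩
    _ = _ := by rw [Finset.sum_const, nsmul_eq_mul]

end PrimeSums

section Convergence

variable {a1 a2 : ℤ}

lemma card_primes_dvd_lucasU_le (hnd : LucasNondegenerate a1 a2) (h2 : a2 ≠ 0) {e : ℕ}
    (he : 0 < e) {s : Finset ℕ} (hs : ∀ p ∈ s, p.Prime ∧ (p : ℤ) ∣ lucasU a1 a2 e) :
    s.card ≤ (1 + a1.natAbs + a2.natAbs) * e := by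
  have hu : (lucasU a1 a2 e).natAbs ≠ 0 := Int.natAbs_ne_zero.mpr (hnd.lucasU_ne_zero h2 he)
  have hle : (lucasU a1 a2 e).natAbs ≤ (1 + a1.natAbs + a2.natAbs) ^ e := by
    zify
    exact abs_lucasU_le e
  have hsub : s ⊆ (lucasU a1 a2 e).natAbs.primeFactors := fun p hp =>
    Nat.mem_primeFactors.mpr ⟨(hs p hp).1, Int.natCast_dvd.mp (hs p hp).2, hu⟩
  have hpow : 2 ^ s.card ≤ 2 ^ ((1 + a1.natAbs + a2.natAbs) * e) := by
    calc 2 ^ s.card ≤ ∏ p ∈ s, p := Finset.pow_card_le_prod _ _ _ fun p hp => (hs p hp).1.two_le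
      _ ≤ ∏ p ∈ (lucasU a1 a2 e).natAbs.primeFactors, p :=
          Finset.prod_le_prod_of_subset_of_one_le' hsub fun p hp _ =>
            (Nat.prime_of_mem_primeFactors hp).one_le
      _ ≤ (lucasU a1 a2 e).natAbs :=
          Nat.le_of_dvd (Nat.pos_of_ne_zero hu) (Nat.prod_primeFactors_dvd _)
      _ ≤ (1 + a1.natAbs + a2.natAbs) ^ e := hle
      _ ≤ (2 ^ (1 + a1.natAbs + a2.natAbs)) ^ e :=
          Nat.pow_le_pow_left Nat.lt_two_pow_self.le _
      _ = _ := (pow_mul _ _ _).symm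
  exact (Nat.pow_le_pow_iff_right (by norm_num)).mp hpow

lemma summable_inv_lucasZ_pow_four (hnd : LucasNondegenerate a1 a2) (h2 : a2 ≠ 0) :
    Summable fun p : ℕ =>
      if p.Prime ∧ Int.gcd p a2 = 1 then ((lucasZ a1 a2 p : ℝ) ^ 4)⁻¹ else 0 := by
  set A : ℕ := 1 + a1.natAbs + a2.natAbs with hA
  have hsum : Summable fun e : ℕ => (A : ℝ) * ((e : ℝ) ^ 3)⁻¹ :=
    (Real.summable_nat_pow_inv.mpr (by norm_num)).mul_left _
  refine summable_of_sum_le (c := ∑' e : ℕ, (A : ℝ) * ((e : ℝ) ^ 3)⁻¹)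
    (fun p => by dsimp only [Pi.zero_apply]; split_ifs <;> positivity) fun s => ?_
  rw [← Finset.sum_filter]
  set t := s.filter fun p : ℕ => p.Prime ∧ Int.gcd p a2 = 1
  rw [← Finset.sum_fiberwise_of_maps_to (t := t.image (lucasZ a1 a2))
    (fun p hp => Finset.mem_image_of_mem _ hp)]
  refine le_trans (Finset.sum_le_sum fun e he => ?_)
    (hsum.sum_le_tsum (t.image (lucasZ a1 a2)) fun e _ => by positivity)
  obtain ⟨q, hq, rfl⟩ := Finset.mem_image.mp he
  obtain ⟨hqp, hqa⟩ := (Finset.mem_filter.mp hq).2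
  have hz := (lucasZ_spec (a1 := a1) hqp.pos hqa).1
  have hz' : (0 : ℝ) < lucasZ a1 a2 q := by exact_mod_cast hz
  have hcard : ((t.filter fun p => lucasZ a1 a2 p = lucasZ a1 a2 q).card : ℝ) ≤
      A * lucasZ a1 a2 q := by
    rw [hA]
    exact_mod_cast card_primes_dvd_lucasU_le hnd h2 hz fun p hp => by
      obtain ⟨hpt, hpz⟩ := Finset.mem_filter.mp hp
      obtain ⟨hpp, hpa⟩ := (Finset.mem_filter.mp hpt).2
      exact ⟨hpp, hpz ▸ (lucasZ_spec hpp.pos hpa).2⟩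
  calc ∑ p ∈ t with lucasZ a1 a2 p = lucasZ a1 a2 q, ((lucasZ a1 a2 p : ℝ) ^ 4)⁻¹
      = ∑ p ∈ t with lucasZ a1 a2 p = lucasZ a1 a2 q, ((lucasZ a1 a2 q : ℝ) ^ 4)⁻¹ :=
        Finset.sum_congr rfl fun p hp => by rw [(Finset.mem_filter.mp hp).2]
    _ ≤ A * lucasZ a1 a2 q * ((lucasZ a1 a2 q : ℝ) ^ 4)⁻¹ := by
        rw [Finset.sum_const, nsmul_eq_mul]; gcongr
    _ = A * ((lucasZ a1 a2 q : ℝ) ^ 3)⁻¹ := by field_simp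

lemma rpow_mul_sqrt_div_le {p e : ℝ} (hp : 0 < p) (he : 0 < e) :
    p ^ (1 / 16 : ℝ) * √e / (p * e) ≤ p ^ (-(15 / 14) : ℝ) + (e ^ 4)⁻¹ := by
  have h := Real.geom_mean_le_arith_mean2_weighted (w₁ := 7 / 8) (w₂ := 1 / 8)
    (p₁ := p ^ (-(15 / 14) : ℝ)) (p₂ := (e ^ 4)⁻¹) (by norm_num) (by norm_num)
    (by positivity) (by positivity) (by norm_num)
  have h1 : (p ^ (-(15 / 14) : ℝ)) ^ (7 / 8 : ℝ) = p ^ (1 / 16 : ℝ) / p := by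
    rw [← Real.rpow_mul hp.le, ← Real.rpow_sub_one hp.ne']; norm_num
  have h2 : ((e ^ 4)⁻¹) ^ (1 / 8 : ℝ) = √e / e := by
    rw [Real.sqrt_eq_rpow, ← Real.rpow_sub_one he.ne', ← Real.rpow_natCast,
      ← Real.rpow_neg he.le, ← Real.rpow_mul he.le]
    norm_num
  rw [h1, h2, div_mul_div_comm] at h
  have h3 : 0 ≤ p ^ (-(15 / 14) : ℝ) := by positivity
  have h4 : 0 ≤ (e ^ 4)⁻¹ := by positivity
  linarith

lemma Squarefree.dvd_primorial_of_le {d N : ℕ} (hd : Squarefree d)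
    (h : ∀ q, q.Prime → q ∣ d → q ≤ N) : d ∣ primorial N := by
  rw [← Nat.prod_primeFactors_of_squarefree hd, primorial_eq_prod_primesLE]
  refine Finset.prod_dvd_prod_of_subset _ _ _ fun q hq => ?_
  have hq' := Nat.prime_of_mem_primeFactors hq
  exact Nat.mem_primesLE.mpr ⟨h q hq' (Nat.dvd_of_mem_primeFactors hq), hq'⟩

lemma inv_lucasL_le (hco : IsCoprime a1 a2) {k p m : ℕ} (hk : 0 < k) (hka : Int.gcd k a2 = 1)
    (hp : p.Prime) (hpd : ¬ (p : ℤ) ∣ a1 ^ 2 + 4 * a2) (hm : Squarefree (p * m))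
    (hma : Int.gcd (p * m : ℕ) a2 = 1) :
    (lucasL a1 a2 (p * m * k) : ℝ)⁻¹ ≤
      (Nat.gcd m (lucasZ a1 a2 p) : ℝ) / m / (p * lucasZ a1 a2 p) := by
  have hpm : 0 < p * m := Nat.pos_of_ne_zero hm.ne_zero
  have hm0 : 0 < m := Nat.pos_of_mul_pos_left hpm
  have hpa : Int.gcd p a2 = 1 := Nat.Coprime.coprime_dvd_left (dvd_mul_right p m) hma
  have hda : Int.gcd (p * m * k : ℕ) a2 = 1 := natCast_mul_gcd_eq_one hma hka
  have hd0 : 0 < p * m * k := Nat.mul_pos hpm hk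
  have hz : 0 < lucasZ a1 a2 p := (lucasZ_spec hp.pos hpa).1
  have hL := lucasL_pos (a1 := a1) hd0 hda
  have hdvd : p * Nat.lcm m (lucasZ a1 a2 p) ∣ lucasL a1 a2 (p * m * k) := by
    have hdL : p * m * k ∣ lucasL a1 a2 (p * m * k) := Nat.dvd_lcm_left _ _
    have hzL : lucasZ a1 a2 p ∣ lucasL a1 a2 (p * m * k) :=
      (lucasZ_dvd_lucasZ hco hd0 hda (by rw [mul_assoc]; exact dvd_mul_right _ _)).trans
        (Nat.dvd_lcm_right _ _)
    refine Nat.Coprime.mul_dvd_of_dvd_of_dvd ?_ ?_ ?_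
    · refine Nat.Coprime.coprime_dvd_right (Nat.lcm_dvd_mul _ _) (Nat.Coprime.mul_right ?_ ?_)
      · exact Nat.coprime_of_squarefree_mul hm
      · exact (Nat.Prime.coprime_iff_not_dvd hp).mpr (not_dvd_lucasZ_self hco hp hpa hpd)
    · exact (Dvd.intro _ (mul_assoc p m k).symm).trans hdL
    · exact Nat.lcm_dvd ((Dvd.intro_left p rfl).trans ((dvd_mul_right _ k).trans hdL)) hzL
  have hle : p * (m * lucasZ a1 a2 p) ≤
      Nat.gcd m (lucasZ a1 a2 p) * lucasL a1 a2 (p * m * k) := by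
    calc p * (m * lucasZ a1 a2 p)
        = Nat.gcd m (lucasZ a1 a2 p) * (p * Nat.lcm m (lucasZ a1 a2 p)) := by
          rw [← Nat.gcd_mul_lcm m (lucasZ a1 a2 p)]; ring
      _ ≤ _ := Nat.mul_le_mul_left _ (Nat.le_of_dvd hL hdvd)
  have hle' : (p : ℝ) * (m * lucasZ a1 a2 p) ≤
      Nat.gcd m (lucasZ a1 a2 p) * lucasL a1 a2 (p * m * k) := by exact_mod_cast hle
  have hp' : (0 : ℝ) < p := by exact_mod_cast hp.pos
  have hm' : (0 : ℝ) < m := by exact_mod_cast hm0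
  have hz' : (0 : ℝ) < lucasZ a1 a2 p := by exact_mod_cast hz
  have hL' : (0 : ℝ) < lucasL a1 a2 (p * m * k) := by exact_mod_cast hL
  rw [div_div, le_div_iff₀ (by positivity), inv_mul_le_iff₀ hL']
  linarith

/-- The terms of the series whose index has largest prime factor `p`. -/
lemma sum_inv_lucasL_le (hco : IsCoprime a1 a2) {k p : ℕ} (hk : 0 < k) (hka : Int.gcd k a2 = 1)
    (hp : p.Prime) (hpa : Int.gcd p a2 = 1) (hpd : ¬ (p : ℤ) ∣ a1 ^ 2 + 4 * a2) {C : ℝ}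
    (hC : ∑ m ∈ (primorial p).divisors, (m : ℝ)⁻¹ ≤ C * (p : ℝ) ^ (1 / 16 : ℝ))
    (hC0 : 0 ≤ C) {s : Finset ℕ}
    (hs : ∀ d ∈ s, Squarefree d ∧ Int.gcd d a2 = 1 ∧ p ∣ d ∧ ∀ q, q.Prime → q ∣ d → q ≤ p) :
    ∑ d ∈ s, (lucasL a1 a2 (d * k) : ℝ)⁻¹ ≤
      2 * C * ((p : ℝ) ^ (-(15 / 14) : ℝ) + ((lucasZ a1 a2 p : ℝ) ^ 4)⁻¹) := by
  have hz : 0 < lucasZ a1 a2 p := (lucasZ_spec hp.pos hpa).1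
  have hp' : (0 : ℝ) < p := by exact_mod_cast hp.pos
  have hz' : (0 : ℝ) < lucasZ a1 a2 p := by exact_mod_cast hz
  set e := lucasZ a1 a2 p
  have hinj : Set.InjOn (· / p) (s : Set ℕ) := by
    intro a ha b hb hab
    rw [← Nat.div_mul_cancel (hs a ha).2.2.1, ← Nat.div_mul_cancel (hs b hb).2.2.1]
    exact congrArg (· * p) hab
  calc ∑ d ∈ s, (lucasL a1 a2 (d * k) : ℝ)⁻¹
      ≤ ∑ d ∈ s, (Nat.gcd (d / p) e : ℝ) / (d / p : ℕ) / (p * e) := by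
        refine Finset.sum_le_sum fun d hd => ?_
        obtain ⟨h1, h2, ⟨m, rfl⟩, -⟩ := hs d hd
        rw [Nat.mul_div_cancel_left _ hp.pos]
        exact inv_lucasL_le hco hk hka hp hpd h1 h2
    _ = ∑ m ∈ s.image (· / p), (Nat.gcd m e : ℝ) / m / (p * e) :=
        (Finset.sum_image (f := fun m : ℕ => (Nat.gcd m e : ℝ) / m / (p * e)) hinj).symm
    _ ≤ ∑ m ∈ (primorial p).divisors, (Nat.gcd m e : ℝ) / m / (p * e) := by
        refine Finset.sum_le_sum_of_subset_of_nonneg ?_ fun _ _ _ => by positivity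
        intro m hm
        obtain ⟨d, hd, rfl⟩ := Finset.mem_image.mp hm
        obtain ⟨h1, -, h3, h4⟩ := hs d hd
        exact Nat.mem_divisors.mpr
          ⟨(Nat.div_dvd_of_dvd h3).trans (h1.dvd_primorial_of_le h4), primorial_ne_zero p⟩
    _ = (∑ m ∈ (primorial p).divisors, (Nat.gcd m e : ℝ) / m) / (p * e) :=
        (Finset.sum_div _ _ _).symm
    _ ≤ (2 * √e * (C * (p : ℝ) ^ (1 / 16 : ℝ))) / (p * e) := by
        gcongr
        refine (sum_gcd_div_le hz).trans ?_
        gcongr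
        exact card_divisors_le_two_mul_sqrt e
    _ = 2 * C * ((p : ℝ) ^ (1 / 16 : ℝ) * √e / (p * e)) := by ring
    _ ≤ _ := by gcongr; exact rpow_mul_sqrt_div_le hp' hz'

lemma summable_inv_lucasL (hco : IsCoprime a1 a2) (hne : a1 * a2 ≠ 0)
    (hnd : LucasNondegenerate a1 a2) {k : ℕ} (hk : 0 < k) (hka : Int.gcd k a2 = 1) :
    Summable fun d : ℕ =>
      if Squarefree d ∧ Int.gcd d a2 = 1 then (lucasL a1 a2 (d * k) : ℝ)⁻¹ else 0 := by
  obtain ⟨C, hC0, hC⟩ := exists_sum_inv_divisors_primorial_le (δ := 1 / 16) (by norm_num)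
  set B := (a1 ^ 2 + 4 * a2).natAbs
  have hdisc := hnd.disc_ne_zero (left_ne_zero_of_mul hne)
  set h : ℕ → ℝ := fun p => 2 * C * ((p : ℝ) ^ (-(15 / 14) : ℝ) +
    if p.Prime ∧ Int.gcd p a2 = 1 then ((lucasZ a1 a2 p : ℝ) ^ 4)⁻¹ else 0) with hh
  have hh0 : ∀ p, 0 ≤ h p := fun p => by
    simp only [hh]; split_ifs <;> positivity
  have hsum : Summable h :=
    ((Real.summable_nat_rpow.mpr (by norm_num)).add
      (summable_inv_lucasZ_pow_four hnd (right_ne_zero_of_mul hne))).mul_left _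
  refine summable_of_sum_le
    (c := ∑ d ∈ (primorial B).divisors, (lucasL a1 a2 (d * k) : ℝ)⁻¹ + ∑' p, h p)
    (fun d => by dsimp only [Pi.zero_apply]; split_ifs <;> positivity) fun u => ?_
  rw [← Finset.sum_filter]
  set t := u.filter fun d : ℕ => Squarefree d ∧ Int.gcd d a2 = 1
  let P : ℕ → ℕ := fun d => d.primeFactors.sup id
  have hPle : ∀ d ≠ 0, ∀ q, q.Prime → q ∣ d → q ≤ P d := fun d hd q hq hqd =>
    Finset.le_sup (f := id) (Nat.mem_primeFactors.mpr ⟨hq, hqd, hd⟩)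
  rw [← Finset.sum_filter_add_sum_filter_not t fun d => P d ≤ B]
  refine add_le_add ?_ ?_
  · refine Finset.sum_le_sum_of_subset_of_nonneg ?_ fun _ _ _ => by positivity
    intro d hd
    obtain ⟨hdt, hdB⟩ := Finset.mem_filter.mp hd
    have hsq := (Finset.mem_filter.mp hdt).2.1
    exact Nat.mem_divisors.mpr ⟨hsq.dvd_primorial_of_le fun q hq hqd =>
      (hPle d hsq.ne_zero q hq hqd).trans hdB, primorial_ne_zero B⟩
  · set v := t.filter fun d => ¬ P d ≤ B
    rw [← Finset.sum_fiberwise_of_maps_to (t := v.image P)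
      (fun d hd => Finset.mem_image_of_mem _ hd)]
    refine le_trans (Finset.sum_le_sum fun p hp => ?_)
      (hsum.sum_le_tsum (v.image P) fun p _ => hh0 p)
    have hv : ∀ d ∈ v, Squarefree d ∧ Int.gcd d a2 = 1 ∧ (P d).Prime ∧ P d ∣ d ∧ B < P d := by
      intro d hd
      obtain ⟨hdt, hdB⟩ := Finset.mem_filter.mp hd
      obtain ⟨hsq, hda⟩ := (Finset.mem_filter.mp hdt).2
      have hnon : d.primeFactors.Nonempty := by
        rw [Finset.nonempty_iff_ne_empty]
        intro h0
        exact hdB (by simp [P, h0])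
      obtain ⟨q, hq, hqP⟩ := Finset.exists_mem_eq_sup d.primeFactors hnon id
      have hqP' : P d = q := hqP
      rw [hqP'] at hdB ⊢
      exact ⟨hsq, hda, Nat.prime_of_mem_primeFactors hq, Nat.dvd_of_mem_primeFactors hq,
        not_le.mp hdB⟩
    obtain ⟨c, hc, rfl⟩ := Finset.mem_image.mp hp
    obtain ⟨-, hca, hcp, hcd, hcB⟩ := hv c hc
    have hpa : Int.gcd (P c) a2 = 1 :=
      Nat.Coprime.coprime_dvd_left (by simpa using hcd) hca
    have hpd : ¬ ((P c : ℕ) : ℤ) ∣ a1 ^ 2 + 4 * a2 := fun hdvd =>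
      absurd (Nat.le_of_dvd (Int.natAbs_pos.mpr hdisc) (Int.natCast_dvd.mp hdvd)) hcB.not_ge
    simp only [hh, if_pos (And.intro hcp hpa)]
    refine sum_inv_lucasL_le hco hk hka hcp hpa hpd (hC _ hcp.pos) hC0.le fun d hd => ?_
    obtain ⟨hdv, hdP⟩ := Finset.mem_filter.mp hd
    obtain ⟨hsq, hda, -, hdvd, -⟩ := hv d hdv
    exact ⟨hsq, hda, hdP ▸ hdvd, fun q hq hqd => hdP ▸ hPle d hsq.ne_zero q hq hqd⟩

end Convergence

section Density

variable {a1 a2 : ℤ}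

open ArithmeticFunction in
lemma sum_moebius_divisors (n : ℕ) :
    ∑ d ∈ n.divisors, (moebius d : ℝ) = if n = 1 then 1 else 0 := by
  have h := congrArg (fun f : ArithmeticFunction ℤ => f n) moebius_mul_coe_zeta
  simp only [coe_mul_zeta_apply, one_apply] at h
  exact_mod_cast h

/-- The indicator function of `A_{u,k}` as a sum of Möbius values. -/
lemma indicator_lucasA_eq_sum (hco : IsCoprime a1 a2) {k : ℕ} (hk : 0 < k)
    (hka : Int.gcd k a2 = 1) {n N : ℕ} (hn : 0 < n) (hnN : n ≤ N) :
    (if Int.gcd n (lucasU a1 a2 n) = k then (1 : ℝ) else 0) =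
      ∑ d ∈ Finset.Ioc 0 N, if lucasL a1 a2 (d * k) ∣ n then
        (if Int.gcd (d : ℤ) a2 = 1 then (ArithmeticFunction.moebius d : ℝ) else 0) else 0 := by
  set g := Int.gcd n (lucasU a1 a2 n) with hg
  have hgn : g ∣ n := Nat.gcd_dvd_left _ _
  have hg0 : 0 < g := Nat.pos_of_dvd_of_pos hgn hn
  have key : ∀ d : ℕ, 0 < d →
      (d * k ∣ g ↔ Int.gcd (d : ℤ) a2 = 1 ∧ lucasL a1 a2 (d * k) ∣ n) := by
    intro d hd
    rw [hg, dvd_gcd_lucasU_iff hco (Nat.mul_pos hd hk) hn]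
    refine and_congr_left fun _ => ⟨fun h => Nat.Coprime.coprime_dvd_left (dvd_mul_right d k) h,
      fun h => natCast_mul_gcd_eq_one h hka⟩
  have hsum : (∑ d ∈ Finset.Ioc 0 N, if lucasL a1 a2 (d * k) ∣ n then
        (if Int.gcd (d : ℤ) a2 = 1 then (ArithmeticFunction.moebius d : ℝ) else 0) else 0) =
      ∑ d ∈ Finset.Ioc 0 N with d * k ∣ g, (ArithmeticFunction.moebius d : ℝ) := by
    rw [Finset.sum_filter]
    refine Finset.sum_congr rfl fun d hd => ?_
    rw [← ite_and]
    exact if_congr (by rw [key d (Finset.mem_Ioc.mp hd).1, and_comm]) rfl rfl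
  rw [hsum]
  by_cases hkg : k ∣ g
  · obtain ⟨m, hm⟩ := hkg
    have hm0 : 0 < m := Nat.pos_of_ne_zero (by rintro rfl; simp at hm; omega)
    have hset : (Finset.Ioc 0 N).filter (fun d => d * k ∣ g) = m.divisors := by
      ext d
      rw [Finset.mem_filter, Finset.mem_Ioc, Nat.mem_divisors, hm, mul_comm d k,
        Nat.mul_dvd_mul_iff_left hk]
      refine ⟨fun h => ⟨h.2, hm0.ne'⟩, fun h => ⟨⟨Nat.pos_of_dvd_of_pos h.1 hm0, ?_⟩, h.1⟩⟩
      have h1 : m ∣ n := (Dvd.intro_left k hm.symm).trans hgn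
      exact (Nat.le_of_dvd hn (h.1.trans h1)).trans hnN
    rw [hset, sum_moebius_divisors]
    refine if_congr ?_ rfl rfl
    rw [hm]
    exact ⟨fun h => by simpa [hk.ne'] using h, fun h => by rw [h, mul_one]⟩
  · rw [if_neg fun h => hkg h.symm.dvd, Finset.filter_false_of_mem fun d _ h =>
      hkg ((dvd_mul_left k d).trans h), Finset.sum_empty]

lemma countIn_lucasA_eq_tsum (hco : IsCoprime a1 a2) {k : ℕ} (hk : 0 < k)
    (hka : Int.gcd k a2 = 1) {x : ℝ} (hx : 0 ≤ x) :
    (countIn (lucasA a1 a2 k) x : ℝ) =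
      ∑' d : ℕ, (if Int.gcd (d : ℤ) a2 = 1 then (ArithmeticFunction.moebius d : ℝ) else 0) *
        (⌊x / lucasL a1 a2 (d * k)⌋₊ : ℝ) := by
  set N := ⌊x⌋₊ with hN
  have hset : lucasA a1 a2 k ∩ {n : ℕ | 1 ≤ n ∧ (n : ℝ) ≤ x} =
      ((Finset.Ioc 0 N).filter fun n : ℕ => Int.gcd n (lucasU a1 a2 n) = k : Finset ℕ) := by
    ext n
    simp only [lucasA, Set.mem_inter_iff, Set.mem_ofPred_eq, Finset.coe_filter, Finset.mem_Ioc, hN,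
      Nat.le_floor_iff hx]
    constructor
    · rintro ⟨⟨h1, h2⟩, h3, h4⟩; exact ⟨⟨h1, h4⟩, h2⟩
    · rintro ⟨⟨h1, h4⟩, h2⟩; exact ⟨⟨h1, h2⟩, h1, h4⟩
  rw [countIn, hset, Set.ncard_coe_finset, Finset.natCast_card_filter,
    Finset.sum_congr rfl fun n hn => indicator_lucasA_eq_sum hco hk hka
      (Finset.mem_Ioc.mp hn).1 (Finset.mem_Ioc.mp hn).2, Finset.sum_comm,
    tsum_eq_sum (s := Finset.Ioc 0 N)]
  · refine Finset.sum_congr rfl fun d _ => ?_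
    rw [← Finset.sum_filter, Finset.sum_const, Nat.Ioc_filter_dvd_card_eq_div, nsmul_eq_mul,
      mul_comm, Nat.floor_div_natCast]
  · intro d hd
    rcases Nat.eq_zero_or_pos d with rfl | hd0
    · simp
    · rw [Finset.mem_Ioc, not_and, not_le] at hd
      by_cases hda : Int.gcd (d : ℤ) a2 = 1
      · have hdk : Int.gcd (d * k : ℕ) a2 = 1 := natCast_mul_gcd_eq_one hda hka
        have hL := lucasL_pos (a1 := a1) (Nat.mul_pos hd0 hk) hdk
        have hle : d ≤ lucasL a1 a2 (d * k) :=
          Nat.le_of_dvd hL ((dvd_mul_right d k).trans (Nat.dvd_lcm_left _ _))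
        rw [Nat.floor_div_natCast, Nat.div_eq_of_lt ((hd hd0).trans_le hle), Nat.cast_zero,
          mul_zero]
      · rw [if_neg hda, zero_mul]

end Density

theorem density_of_lucasA (a1 a2 : ℤ) (hco : IsCoprime a1 a2) (hne : a1 * a2 ≠ 0)
    (hnd : LucasNondegenerate a1 a2) (k : ℕ) (hk : 0 < k)
    (hk1 : Int.gcd (k : ℤ) a2 = 1)
    (hk2 : k = Int.gcd (lucasL a1 a2 k : ℤ) (lucasU a1 a2 (lucasL a1 a2 k))) :
    Summable (fun d : ℕ =>
        if Int.gcd (d : ℤ) a2 = 1 then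
          (ArithmeticFunction.moebius d : ℝ) / (lucasL a1 a2 (d * k) : ℝ)
        else 0) ∧
      Summable (fun d : ℕ =>
        |if Int.gcd (d : ℤ) a2 = 1 then
          (ArithmeticFunction.moebius d : ℝ) / (lucasL a1 a2 (d * k) : ℝ)
        else 0|) ∧
      HasDensity (lucasA a1 a2 k)
        (∑' d : ℕ, if Int.gcd (d : ℤ) a2 = 1 then
          (ArithmeticFunction.moebius d : ℝ) / (lucasL a1 a2 (d * k) : ℝ) else 0) := by
  set c : ℕ → ℝ := fun d =>
    if Int.gcd (d : ℤ) a2 = 1 then (ArithmeticFunction.moebius d : ℝ) else 0 with hc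
  have hcoef : ∀ d : ℕ, (if Int.gcd (d : ℤ) a2 = 1 then
      (ArithmeticFunction.moebius d : ℝ) / (lucasL a1 a2 (d * k) : ℝ) else 0) =
      c d * (lucasL a1 a2 (d * k) : ℝ)⁻¹ := fun d => by
    simp only [hc, div_eq_mul_inv, ite_mul, zero_mul]
  simp only [hcoef]
  have habs : Summable fun d : ℕ => |c d * (lucasL a1 a2 (d * k) : ℝ)⁻¹| := by
    refine (summable_inv_lucasL hco hne hnd hk hk1).congr fun d => ?_
    simp only [hc]
    by_cases hda : Int.gcd (d : ℤ) a2 = 1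
    · by_cases hsq : Squarefree d
      · have : |(ArithmeticFunction.moebius d : ℝ)| = 1 := by
          exact_mod_cast ArithmeticFunction.abs_moebius_eq_one_of_squarefree hsq
        rw [if_pos ⟨hsq, hda⟩, if_pos hda, abs_mul, this, one_mul, abs_of_nonneg (by positivity)]
      · simp [hsq, hda, ArithmeticFunction.moebius_eq_zero_of_not_squarefree hsq]
    · simp [hda]
  refine ⟨habs.of_abs, habs, ?_⟩
  have hlim : Filter.Tendsto
      (fun x : ℝ => ∑' d : ℕ, c d * ((⌊x / lucasL a1 a2 (d * k)⌋₊ : ℝ) / x)) Filter.atTop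
      (nhds (∑' d : ℕ, c d * (lucasL a1 a2 (d * k) : ℝ)⁻¹)) := by
    refine tendsto_tsum_of_dominated_convergence habs (fun d => ?_) ?_
    · refine Filter.Tendsto.const_mul _ ?_
      simp_rw [div_eq_inv_mul _ (lucasL a1 a2 (d * k) : ℝ)]
      exact tendsto_nat_floor_mul_div_atTop (by positivity)
    · filter_upwards [Filter.eventually_gt_atTop 0] with x hx d
      rw [Real.norm_eq_abs, abs_mul, abs_mul,
        abs_of_nonneg (a := (⌊x / lucasL a1 a2 (d * k)⌋₊ : ℝ) / x) (by positivity),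
        abs_of_nonneg (a := (lucasL a1 a2 (d * k) : ℝ)⁻¹) (by positivity)]
      gcongr
      rw [div_le_iff₀ hx, inv_mul_eq_div]
      exact Nat.floor_le (by positivity)
  refine hlim.congr' ?_
  filter_upwards [Filter.eventually_gt_atTop 0] with x hx
  rw [countIn_lucasA_eq_tsum hco hk hk1 hx.le, ← tsum_div_const]
  simp only [hc, mul_div_assoc]
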